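/- For all positive integers n and m, the polynomial (x_1 + x_2 + ⋯ + x_n)^m equals the sum, over all partitions λ of m, of f^λ · s_λ(x_1,…,x_n), where f^λ is the number of standard Young tableaux of shape λ (only partitions with at most n parts contribute, since s_λ = 0 otherwise). -/

import Mathlib

/-- The weight of a semistandard Young tableau: `ssytWeight T i` is the number of cells of the
tableau whose entry equals `i`. -/
def ssytWeight {μ : YoungDiagram} (T : SemistandardYoungTableau μ) (i : ℕ) : ℕ :=
  (μ.cells.filter fun c => T c.1 c.2 = i).card

/-- `tabCard μ ν` is the number of semistandard Young tableaux of shape `μ` and weight `ν`,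
where `ν : Fin n → ℕ`: the entry `j` (for `j < n`) occurs exactly `ν j` times, and no entry
`≥ n` occurs. -/
noncomputable def tabCard (μ : YoungDiagram) {n : ℕ} (ν : Fin n → ℕ) : ℕ :=
  Set.ncard {T : SemistandardYoungTableau μ |
    ∀ j : ℕ, ssytWeight T j = if h : j < n then ν ⟨j, h⟩ else 0}

/-- The Schur polynomial `s_μ(x_0, …, x_{n-1})`, as the generating function of semistandard
Young tableaux of shape `μ` with entries in `{0, …, n-1}`. -/
noncomputable def schurPoly (n : ℕ) (μ : YoungDiagram) : MvPolynomial (Fin n) ℤ :=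
  ∑ᶠ (T : SemistandardYoungTableau μ) (_ : ∀ c ∈ μ.cells, T c.1 c.2 < n),
    ∏ i : Fin n, (MvPolynomial.X i : MvPolynomial (Fin n) ℤ) ^ ssytWeight T (i : ℕ)

/-- The number of odd rows (odd parts) of a Young diagram. -/
def oddRowsCount (lam : YoungDiagram) : ℕ :=
  lam.rowLens.countP fun r => r % 2 = 1

/-- The number of odd columns of a Young diagram. -/
def oddColsCount (lam : YoungDiagram) : ℕ :=
  oddRowsCount lam.transpose

/-- A Young diagram is a *threshold* partition if its Frobenius coordinates satisfy
`β i = α i + 1` for each `i` up to the Durfee rank; with 0-indexed diagrams this says that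
`colLen i = rowLen i + 1` for each diagonal cell `(i, i)`. -/
def YoungDiagram.IsThreshold (lam : YoungDiagram) : Prop :=
  ∀ i : ℕ, (i, i) ∈ lam → lam.colLen i = lam.rowLen i + 1

open Finset

namespace YoungDiagram

theorem card_eq_sum_rowLen (μ : YoungDiagram) {N : ℕ} (hN : ∀ i, N ≤ i → μ.rowLen i = 0) :
    μ.card = ∑ i ∈ range N, μ.rowLen i := by
  have hmaps : Set.MapsTo (fun c : ℕ × ℕ => c.1) (μ.cells : Set (ℕ × ℕ)) (range N : Finset ℕ) := by
    intro c hc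
    rw [Finset.mem_coe, mem_range]
    by_contra! h
    have hc' : (c.1, c.2) ∈ μ := by simpa using hc
    rw [mem_iff_lt_rowLen, hN _ h] at hc'
    omega
  rw [YoungDiagram.card, card_eq_sum_card_fiberwise hmaps]
  exact sum_congr rfl fun i _ => (μ.rowLen_eq_card).symm

theorem lt_card_of_mem {μ : YoungDiagram} {i j : ℕ} (h : (i, j) ∈ μ) : i < μ.card ∧ j < μ.card := by
  constructor
  · have h0 : (i, 0) ∈ μ := μ.up_left_mem le_rfl (Nat.zero_le j) h
    rw [mem_iff_lt_colLen, colLen_eq_card] at h0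
    exact h0.trans_le (card_le_card (filter_subset _ _))
  · have h0 : (0, j) ∈ μ := μ.up_left_mem (Nat.zero_le i) le_rfl h
    rw [mem_iff_lt_rowLen, rowLen_eq_card] at h0
    exact h0.trans_le (card_le_card (filter_subset _ _))

theorem rowLen_eq_zero_of_card_le {μ : YoungDiagram} {i : ℕ} (h : μ.card ≤ i) :
    μ.rowLen i = 0 := by
  by_contra h0
  have := (lt_card_of_mem (mem_iff_lt_rowLen.2 (Nat.pos_of_ne_zero h0))).1
  omega

theorem finite_card_le (N : ℕ) : {μ : YoungDiagram | μ.card ≤ N}.Finite := by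
  refine Set.Finite.of_finite_image (f := YoungDiagram.cells)
    ((finite_toSet (range N ×ˢ range N).powerset).subset ?_) ?_
  · rintro _ ⟨μ, hμ, rfl⟩
    rw [Finset.mem_coe, mem_powerset]
    intro c hc
    have := lt_card_of_mem (μ := μ) (i := c.1) (j := c.2) (by simpa using hc)
    have hμ : μ.card ≤ N := hμ
    rw [mem_product, mem_range, mem_range]
    omega
  · intro μ _ ν _ h
    exact YoungDiagram.ext h

/-- The finite set of Young diagrams with at most `N` cells. -/
noncomputable def cardLE (N : ℕ) : Finset YoungDiagram := (finite_card_le N).toFinset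

@[simp] theorem mem_cardLE {N : ℕ} {μ : YoungDiagram} : μ ∈ cardLE N ↔ μ.card ≤ N := by
  simp [cardLE]

theorem eq_of_rowLen_eq {μ ν : YoungDiagram} (h : ∀ i, μ.rowLen i = ν.rowLen i) : μ = ν := by
  refine SetLike.ext fun c => ?_
  obtain ⟨i, j⟩ := c
  rw [mem_iff_lt_rowLen, mem_iff_lt_rowLen, h]

theorem exists_rowLen_eq {r : ℕ → ℕ} (hr : ∀ i, r (i + 1) ≤ r i) {N : ℕ} (hN : ∀ i, N ≤ i → r i = 0) :
    ∃ μ : YoungDiagram, ∀ i, μ.rowLen i = r i := by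
  have hanti : Antitone r := antitone_nat_of_succ_le hr
  have hmem : ∀ i j, (i, j) ∈ (range N ×ˢ range (r 0)).filter (fun c => c.2 < r c.1) ↔ j < r i := by
    intro i j
    simp only [mem_filter, mem_product, mem_range, and_iff_right_iff_imp]
    intro h
    refine ⟨?_, h.trans_le (hanti (Nat.zero_le i))⟩
    by_contra! hi
    rw [hN i hi] at h
    omega
  refine ⟨⟨(range N ×ˢ range (r 0)).filter fun c => c.2 < r c.1, ?_⟩, fun i => ?_⟩
  · rintro ⟨a, b⟩ ⟨c, d⟩ ⟨h1, h2⟩ h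
    rw [Finset.mem_coe, hmem] at h ⊢
    exact h2.trans_lt (h.trans_le (hanti h1))
  · refine eq_of_forall_lt_iff fun j => ?_
    rw [← mem_iff_lt_rowLen]
    exact hmem i j

theorem rowLen_le_rowLen {μ ν : YoungDiagram} {i k : ℕ} :
    μ.rowLen i ≤ ν.rowLen k ↔ ∀ j, (i, j) ∈ μ → (k, j) ∈ ν := by
  simp only [mem_iff_lt_rowLen]
  exact ⟨fun h j hj => hj.trans_le h, fun h => le_of_forall_lt h⟩

/-- `IsHorizontalStrip μ ν` says that `μ` is contained in `ν` and the skew diagram `ν / μ` has at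
most one cell in each column. -/
def IsHorizontalStrip (μ ν : YoungDiagram) : Prop :=
  ∀ i, μ.rowLen i ≤ ν.rowLen i ∧ ν.rowLen (i + 1) ≤ μ.rowLen i

theorem isHorizontalStrip_iff {μ ν : YoungDiagram} :
    IsHorizontalStrip μ ν ↔ μ ≤ ν ∧ ∀ i j, (i + 1, j) ∈ ν → (i, j) ∈ μ := by
  simp only [IsHorizontalStrip, rowLen_le_rowLen, forall_and]
  exact and_congr_left fun _ => ⟨fun h c hc => h c.1 c.2 hc, fun h i j hc => h hc⟩

theorem IsHorizontalStrip.card_le {μ ν : YoungDiagram} (h : IsHorizontalStrip μ ν) :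
    μ.card ≤ ν.card :=
  card_le_card (cells_subset_iff.2 (isHorizontalStrip_iff.1 h).1)

/-- `AddsCell μ ν i` says that `ν` is obtained from `μ` by adding one cell in row `i`. -/
def AddsCell (μ ν : YoungDiagram) (i : ℕ) : Prop :=
  ∀ j, ν.rowLen j = μ.rowLen j + if j = i then 1 else 0

theorem AddsCell.card_eq {μ ν : YoungDiagram} {i : ℕ} (h : AddsCell μ ν i) :
    ν.card = μ.card + 1 := by
  have hN : ∀ k, μ.card + ν.card + i + 1 ≤ k → μ.rowLen k = 0 := fun k hk =>
    rowLen_eq_zero_of_card_le (by omega)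
  have hN' : ∀ k, μ.card + ν.card + i + 1 ≤ k → ν.rowLen k = 0 := fun k hk =>
    rowLen_eq_zero_of_card_le (by omega)
  rw [card_eq_sum_rowLen ν hN', sum_congr rfl fun j _ => h j, sum_add_distrib,
    ← card_eq_sum_rowLen μ hN, sum_ite_eq', if_pos (mem_range.2 (by omega))]

theorem AddsCell.isHorizontalStrip {μ ν : YoungDiagram} {i : ℕ} (h : AddsCell μ ν i) :
    IsHorizontalStrip μ ν := by
  intro j
  have h1 := h j
  have h2 := h (j + 1)
  have h3 := μ.rowLen_anti j (j + 1) (by omega)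
  have h4 := ν.rowLen_anti j (j + 1) (by omega)
  refine ⟨by omega, ?_⟩
  split_ifs at h1 h2 <;> omega

theorem IsHorizontalStrip.exists_addsCell {μ ν : YoungDiagram} (h : IsHorizontalStrip μ ν)
    (hcard : ν.card = μ.card + 1) : ∃ i, AddsCell μ ν i := by
  have hN : ∀ k, μ.card + ν.card ≤ k → μ.rowLen k = 0 := fun k hk =>
    rowLen_eq_zero_of_card_le (by omega)
  have hN' : ∀ k, μ.card + ν.card ≤ k → ν.rowLen k = 0 := fun k hk =>
    rowLen_eq_zero_of_card_le (by omega)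
  have hsum : ∑ i ∈ range (μ.card + ν.card), (ν.rowLen i - μ.rowLen i) = 1 := by
    rw [sum_tsub_distrib _ fun i _ => (h i).1, ← card_eq_sum_rowLen ν hN',
      ← card_eq_sum_rowLen μ hN]
    omega
  obtain ⟨i, hi, hne⟩ := exists_ne_zero_of_sum_ne_zero (hsum.trans_ne one_ne_zero)
  rw [← add_sum_erase _ _ hi] at hsum
  have hzero : ∑ k ∈ (range (μ.card + ν.card)).erase i, (ν.rowLen k - μ.rowLen k) = 0 := by omega
  refine ⟨i, fun j => ?_⟩
  have hj := (h j).1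
  split_ifs with hji
  · subst hji
    omega
  · by_cases hjN : j < μ.card + ν.card
    · have := sum_eq_zero_iff.1 hzero j (mem_erase.2 ⟨hji, mem_range.2 hjN⟩)
      omega
    · rw [hN j (by omega), hN' j (by omega)]

theorem AddsCell.row_unique {μ ν : YoungDiagram} {i k : ℕ} (h : AddsCell μ ν i)
    (h' : AddsCell μ ν k) : i = k := by
  have h1 := h i
  have h2 := h' i
  by_contra hik
  simp only [if_true, hik, if_false] at h1 h2
  omega

/-- Rows of `lam` in which a cell can be added to give a diagram `ν` with `ν / μ` a horizontal
strip. -/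
def addRows (lam μ : YoungDiagram) : Set ℕ :=
  {i | ∀ j, μ.rowLen j ≤ lam.rowLen j + (if j = i then 1 else 0) ∧
    lam.rowLen (j + 1) + (if j + 1 = i then 1 else 0) ≤ μ.rowLen j}

/-- Rows of `μ` from which a cell can be removed to give a diagram `κ` with `lam / κ` a horizontal
strip. -/
def removeRows (lam μ : YoungDiagram) : Set ℕ :=
  {i | ∀ j, μ.rowLen j ≤ lam.rowLen j + (if j = i then 1 else 0) ∧
    lam.rowLen (j + 1) + (if j = i then 1 else 0) ≤ μ.rowLen j}

theorem mem_addRows_iff {lam μ : YoungDiagram} {i : ℕ} :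
    i ∈ addRows lam μ ↔ ∃ ν, AddsCell lam ν i ∧ IsHorizontalStrip μ ν := by
  constructor
  · intro h
    obtain ⟨ν, hν⟩ := exists_rowLen_eq (r := fun j => lam.rowLen j + if j = i then 1 else 0)
      (fun j => (h j).2.trans (h j).1) (N := lam.card + i + 1) (by
        intro k hk
        rw [rowLen_eq_zero_of_card_le (by omega), if_neg (by omega)])
    exact ⟨ν, hν, fun j => by rw [hν, hν]; exact h j⟩
  · rintro ⟨ν, hν, hs⟩ j
    rw [← hν, ← hν]
    exact hs j

theorem mem_removeRows_iff {lam μ : YoungDiagram} {i : ℕ} :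
    i ∈ removeRows lam μ ↔ ∃ κ, IsHorizontalStrip κ lam ∧ AddsCell κ μ i := by
  constructor
  · intro h
    obtain ⟨κ, hκ⟩ := exists_rowLen_eq (r := fun j => μ.rowLen j - if j = i then 1 else 0)
      (fun j => by have := (h (j + 1)).1; have := (h j).2; omega) (N := μ.card) (by
        intro k hk
        rw [rowLen_eq_zero_of_card_le hk, Nat.zero_sub])
    refine ⟨κ, fun j => ?_, fun j => ?_⟩
    · have := h j
      rw [hκ]
      omega
    · have := h j
      rw [hκ]
      omega
  · rintro ⟨κ, hs, hκ⟩ j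
    have := hs j
    have := hκ j
    omega

theorem addRows_of_isHorizontalStrip {lam μ : YoungDiagram} (h : IsHorizontalStrip μ lam) :
    addRows lam μ = insert 0 (Nat.succ '' removeRows lam μ) := by
  ext i
  rcases i with _ | i
  · simp only [addRows, Set.mem_ofPred_eq, Set.mem_insert_iff, true_or, iff_true]
    intro j
    have := h j
    rw [if_neg (Nat.succ_ne_zero j)]
    omega
  · simp only [addRows, removeRows, Set.mem_ofPred_eq, Set.mem_insert_iff, Set.mem_image,
      Nat.succ_eq_add_one, Nat.add_right_cancel_iff, exists_eq_right, Nat.add_eq_zero_iff,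
      one_ne_zero, and_false, false_or]
    refine forall_congr' fun j => ?_
    have := h j
    constructor <;> intro h' <;> omega

theorem addRows_of_not_isHorizontalStrip {lam μ : YoungDiagram} (h : ¬ IsHorizontalStrip μ lam) :
    addRows lam μ = removeRows lam μ := by
  have key : ∀ i, (∀ j, μ.rowLen j ≤ lam.rowLen j + (if j = i then 1 else 0) ∧
      lam.rowLen (j + 1) ≤ μ.rowLen j) → μ.rowLen i = lam.rowLen i + 1 := by
    intro i hi
    by_contra hne
    refine h fun j => ⟨?_, (hi j).2⟩
    have := (hi j).1
    split_ifs at this with hji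
    · subst hji
      omega
    · exact this
  ext i
  constructor
  · intro hi j
    have hk := key i fun j => ⟨(hi j).1, le_trans (Nat.le_add_right _ _) (hi j).2⟩
    refine ⟨(hi j).1, ?_⟩
    have h1 := hi j
    split_ifs with hji
    · subst hji
      have := lam.rowLen_anti j (j + 1) (by omega)
      omega
    · omega
  · intro hi j
    have hk := key i fun j => ⟨(hi j).1, le_trans (Nat.le_add_right _ _) (hi j).2⟩
    refine ⟨(hi j).1, ?_⟩
    have h1 := hi j
    split_ifs with hji
    · subst hji
      have := μ.rowLen_anti j (j + 1) (by omega)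
      omega
    · omega

theorem AddsCell.left_unique {μ μ' ν : YoungDiagram} {i : ℕ} (h : AddsCell μ ν i)
    (h' : AddsCell μ' ν i) : μ = μ' :=
  eq_of_rowLen_eq fun j => Nat.add_right_cancel ((h j).symm.trans (h' j))

theorem AddsCell.right_unique {μ ν ν' : YoungDiagram} {i : ℕ} (h : AddsCell μ ν i)
    (h' : AddsCell μ ν' i) : ν = ν' :=
  eq_of_rowLen_eq fun j => (h j).trans (h' j).symm

open Classical in
theorem card_filter_addsCell_left {lam μ : YoungDiagram} {N : ℕ} (hN : lam.card + 1 ≤ N) :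
    #{ν ∈ cardLE N | (∃ i, AddsCell lam ν i) ∧ IsHorizontalStrip μ ν} =
      (addRows lam μ).ncard := by
  rw [← Set.ncard_coe_finset]
  refine Set.ncard_congr (fun ν hν => (mem_filter.1 hν).2.1.choose) ?_ ?_ ?_
  · intro ν hν
    exact mem_addRows_iff.2 ⟨ν, (mem_filter.1 hν).2.1.choose_spec, (mem_filter.1 hν).2.2⟩
  · intro ν ν' hν hν' h
    have h1 := (mem_filter.1 hν).2.1.choose_spec
    rw [h] at h1
    exact h1.right_unique (mem_filter.1 hν').2.1.choose_spec
  · intro i hi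
    obtain ⟨ν, hν, hs⟩ := mem_addRows_iff.1 hi
    have hmem : ν ∈ {ν ∈ cardLE N | (∃ i, AddsCell lam ν i) ∧ IsHorizontalStrip μ ν} :=
      mem_filter.2 ⟨mem_cardLE.2 (hν.card_eq.trans_le hN), ⟨i, hν⟩, hs⟩
    exact ⟨ν, hmem, ((mem_filter.1 hmem).2.1.choose_spec).row_unique hν⟩

open Classical in
theorem card_filter_addsCell_right {lam μ : YoungDiagram} {N : ℕ} (hN : lam.card ≤ N) :
    #{κ ∈ cardLE N | IsHorizontalStrip κ lam ∧ ∃ i, AddsCell κ μ i} =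
      (removeRows lam μ).ncard := by
  rw [← Set.ncard_coe_finset]
  refine Set.ncard_congr (fun κ hκ => (mem_filter.1 hκ).2.2.choose) ?_ ?_ ?_
  · intro κ hκ
    exact mem_removeRows_iff.2 ⟨κ, (mem_filter.1 hκ).2.1, (mem_filter.1 hκ).2.2.choose_spec⟩
  · intro κ κ' hκ hκ' h
    have h1 := (mem_filter.1 hκ).2.2.choose_spec
    rw [h] at h1
    exact h1.left_unique (mem_filter.1 hκ').2.2.choose_spec
  · intro i hi
    obtain ⟨κ, hs, hκ⟩ := mem_removeRows_iff.1 hi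
    have hmem : κ ∈ {κ ∈ cardLE N | IsHorizontalStrip κ lam ∧ ∃ i, AddsCell κ μ i} :=
      mem_filter.2 ⟨mem_cardLE.2 (hs.card_le.trans hN), hs, ⟨i, hκ⟩⟩
    exact ⟨κ, hmem, ((mem_filter.1 hmem).2.2.choose_spec).row_unique hκ⟩

theorem finite_removeRows (lam μ : YoungDiagram) : (removeRows lam μ).Finite := by
  refine (finite_toSet (range μ.card)).subset fun i hi => ?_
  have := (hi i).2
  rw [if_pos rfl] at this
  rw [Finset.mem_coe, mem_range]
  by_contra! h
  rw [rowLen_eq_zero_of_card_le h] at this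
  omega

open Classical in
/-- The operators "add a cell" and "remove a horizontal strip" on Young diagrams commute up to
removing a horizontal strip. -/
theorem card_filter_addsCell_isHorizontalStrip {lam μ : YoungDiagram} {N : ℕ}
    (hN : lam.card + 1 ≤ N) :
    #{ν ∈ cardLE N | (∃ i, AddsCell lam ν i) ∧ IsHorizontalStrip μ ν} =
      #{κ ∈ cardLE N | IsHorizontalStrip κ lam ∧ ∃ i, AddsCell κ μ i} +
        if IsHorizontalStrip μ lam then 1 else 0 := by
  rw [card_filter_addsCell_left hN, card_filter_addsCell_right (by omega)]
  split_ifs with h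
  · rw [addRows_of_isHorizontalStrip h, Set.ncard_insert_of_notMem (by simp)
      ((finite_removeRows lam μ).image _), Set.ncard_image_of_injective _ Nat.succ_injective]
  · rw [addRows_of_not_isHorizontalStrip h, add_zero]

end YoungDiagram

namespace SemistandardYoungTableau

open YoungDiagram

/-- The semistandard Young tableaux of shape `μ` with all entries less than `n`. -/
abbrev BoundedBy (n : ℕ) (μ : YoungDiagram) : Type :=
  {T : SemistandardYoungTableau μ // ∀ c ∈ μ.cells, T c.1 c.2 < n}

instance (n : ℕ) (μ : YoungDiagram) : Finite (BoundedBy n μ) := by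
  refine Finite.of_injective
    (fun (T : BoundedBy n μ) (c : μ.cells) => (⟨T.1 c.1.1 c.1.2, T.2 c.1 c.2⟩ : Fin n)) ?_
  intro T T' h
  refine Subtype.ext (SemistandardYoungTableau.ext fun i j => ?_)
  by_cases hc : (i, j) ∈ μ
  · exact congrArg Fin.val (congrFun h ⟨(i, j), (mem_cells _).2 hc⟩)
  · rw [T.1.zeros hc, T'.1.zeros hc]

noncomputable instance (n : ℕ) (μ : YoungDiagram) : Fintype (BoundedBy n μ) :=
  Fintype.ofFinite _

/-- The subdiagram of the cells of `T` with entry less than `n`. -/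
def subdiagram {μ : YoungDiagram} (T : SemistandardYoungTableau μ) (n : ℕ) : YoungDiagram where
  cells := μ.cells.filter fun c => T c.1 c.2 < n
  isLowerSet := by
    rintro ⟨a, b⟩ ⟨c, d⟩ ⟨h1, h2⟩ h
    simp only [coe_filter, mem_cells, Set.mem_ofPred_eq] at h ⊢
    refine ⟨μ.up_left_mem h1 h2 h.1, lt_of_le_of_lt ?_ h.2⟩
    exact (T.col_weak h1 (μ.up_left_mem le_rfl h2 h.1)).trans (T.row_weak_of_le h2 h.1)

theorem mem_subdiagram {μ : YoungDiagram} {T : SemistandardYoungTableau μ} {n i j : ℕ} :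
    (i, j) ∈ T.subdiagram n ↔ (i, j) ∈ μ ∧ T i j < n := by
  rw [← mem_cells, ← mem_cells]
  exact mem_filter

theorem isHorizontalStrip_subdiagram {μ : YoungDiagram} {n : ℕ} (T : BoundedBy (n + 1) μ) :
    IsHorizontalStrip (T.1.subdiagram n) μ := by
  refine isHorizontalStrip_iff.2 ⟨fun c hc => (mem_subdiagram.1 hc).1, fun i j h => ?_⟩
  have h1 := T.1.col_strict (Nat.lt_add_one i) h
  have h2 := T.2 (i + 1, j) ((mem_cells _).2 h)
  exact mem_subdiagram.2 ⟨μ.up_left_mem (Nat.le_succ i) le_rfl h, by simp only at h2; omega⟩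

/-- The restriction of a tableau to the cells with entry less than `n`. -/
def restrict {μ : YoungDiagram} (T : SemistandardYoungTableau μ) (n : ℕ) :
    SemistandardYoungTableau (T.subdiagram n) where
  entry i j := if (i, j) ∈ T.subdiagram n then T i j else 0
  row_weak' := by
    intro i j1 j2 hj h
    rw [if_pos h, if_pos ((T.subdiagram n).up_left_mem le_rfl hj.le h)]
    exact T.row_weak hj (mem_subdiagram.1 h).1
  col_strict' := by
    intro i1 i2 j hi h
    rw [if_pos h, if_pos ((T.subdiagram n).up_left_mem hi.le le_rfl h)]
    exact T.col_strict hi (mem_subdiagram.1 h).1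
  zeros' := fun h => if_neg h

/-- Extend a tableau with entries less than `n` by a horizontal strip of entries `n`. -/
def extend {μ ν : YoungDiagram} {n : ℕ} (h : IsHorizontalStrip μ ν) (T : BoundedBy n μ) :
    SemistandardYoungTableau ν where
  entry i j := if (i, j) ∈ μ then T.1 i j else if (i, j) ∈ ν then n else 0
  row_weak' := by
    intro i j1 j2 hj hc
    have hT : ∀ {c : ℕ × ℕ}, c ∈ μ → T.1 c.1 c.2 < n := fun hc => T.2 _ ((mem_cells _).2 hc)
    by_cases hc' : (i, j2) ∈ μ
    · rw [if_pos hc', if_pos (μ.up_left_mem le_rfl hj.le hc')]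
      exact T.1.row_weak hj hc'
    · rw [if_neg hc', if_pos hc]
      split_ifs with h1
      exacts [(hT h1).le, le_rfl, Nat.zero_le n]
  col_strict' := by
    intro i1 i2 j hi hc
    have hmem : (i1, j) ∈ μ := (isHorizontalStrip_iff.1 h).2 _ _ (ν.up_left_mem hi le_rfl hc)
    rw [if_pos hmem]
    split_ifs with h1
    · exact T.1.col_strict hi h1
    · exact T.2 _ ((mem_cells _).2 hmem)
  zeros' := by
    intro i j hc
    rw [if_neg fun hμ => hc ((isHorizontalStrip_iff.1 h).1 hμ), if_neg hc]

theorem subdiagram_extend {μ ν : YoungDiagram} {n : ℕ} (h : IsHorizontalStrip μ ν)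
    (T : BoundedBy n μ) : (extend h T).subdiagram n = μ := by
  refine SetLike.ext fun c => ?_
  obtain ⟨i, j⟩ := c
  rw [mem_subdiagram]
  change (i, j) ∈ ν ∧ (if (i, j) ∈ μ then T.1 i j else if (i, j) ∈ ν then n else 0) < n ↔ _
  constructor
  · rintro ⟨h1, h2⟩
    by_contra hc
    rw [if_neg hc, if_pos h1] at h2
    exact lt_irrefl n h2
  · intro hc
    rw [if_pos hc]
    exact ⟨(isHorizontalStrip_iff.1 h).1 hc, T.2 _ ((mem_cells _).2 hc)⟩

theorem extend_mem {μ ν : YoungDiagram} {n : ℕ} (h : IsHorizontalStrip μ ν)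
    (T : BoundedBy n μ) : ∀ c ∈ ν.cells, extend h T c.1 c.2 < n + 1 := by
  intro c _
  change (if (c.1, c.2) ∈ μ then T.1 c.1 c.2 else if (c.1, c.2) ∈ ν then n else 0) < n + 1
  split_ifs with h1
  · exact (T.2 c ((mem_cells _).2 h1)).trans (Nat.lt_succ_self n)
  · omega
  · omega

theorem restrict_mem {μ : YoungDiagram} (T : SemistandardYoungTableau μ) (n : ℕ) :
    ∀ c ∈ (T.subdiagram n).cells, T.restrict n c.1 c.2 < n := by
  intro c hc
  change (if (c.1, c.2) ∈ T.subdiagram n then T c.1 c.2 else 0) < n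
  have hc : (c.1, c.2) ∈ T.subdiagram n := (mem_cells _).1 hc
  rw [if_pos hc]
  exact (mem_subdiagram.1 hc).2

/-- Tableaux of shape `ν` with entries at most `n` correspond to tableaux with entries less than
`n` on a shape whose complement in `ν` is a horizontal strip. -/
def boundedBySuccEquiv (n : ℕ) (ν : YoungDiagram) :
    BoundedBy (n + 1) ν ≃ Σ μ : {μ : YoungDiagram // IsHorizontalStrip μ ν}, BoundedBy n μ.1 where
  toFun T := ⟨⟨T.1.subdiagram n, isHorizontalStrip_subdiagram T⟩, T.1.restrict n, T.1.restrict_mem n⟩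
  invFun p := ⟨extend p.1.2 p.2, extend_mem p.1.2 p.2⟩
  left_inv := by
    intro T
    refine Subtype.ext (SemistandardYoungTableau.ext fun i j => ?_)
    change (if (i, j) ∈ T.1.subdiagram n then
      (if (i, j) ∈ T.1.subdiagram n then T.1 i j else 0) else if (i, j) ∈ ν then n else 0) = T.1 i j
    split_ifs with h1 h2
    · rfl
    · have := T.2 _ ((mem_cells _).2 h2)
      rw [mem_subdiagram] at h1
      simp only at this
      by_contra h3
      exact h1 ⟨h2, by omega⟩
    · exact (T.1.zeros h2).symm
  right_inv := by
    rintro ⟨⟨μ, h⟩, T⟩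
    have key : ∀ (κ : YoungDiagram) (hκ : IsHorizontalStrip κ ν) (T' : BoundedBy n κ), κ = μ →
        (∀ i j, T'.1 i j = T.1 i j) →
        (⟨⟨κ, hκ⟩, T'⟩ : Σ μ : {μ : YoungDiagram // IsHorizontalStrip μ ν}, BoundedBy n μ.1) =
          ⟨⟨μ, h⟩, T⟩ := by
      rintro κ hκ T' rfl hT
      rw [show T' = T from Subtype.ext (SemistandardYoungTableau.ext hT)]
    refine key _ _ _ (subdiagram_extend h T) fun i j => ?_
    change (if (i, j) ∈ (extend h T).subdiagram n then
      (if (i, j) ∈ μ then T.1 i j else if (i, j) ∈ ν then n else 0) else 0) = T.1 i j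
    rw [subdiagram_extend]
    split_ifs with h1
    · rfl
    · exact (T.1.zeros h1).symm

theorem ssytWeight_restrict {μ : YoungDiagram} (T : SemistandardYoungTableau μ) {n j : ℕ}
    (hj : j < n) : ssytWeight (T.restrict n) j = ssytWeight T j := by
  refine congrArg card (Finset.ext fun c => ?_)
  rw [mem_filter, mem_filter, mem_cells, mem_cells]
  change c ∈ T.subdiagram n ∧ (if (c.1, c.2) ∈ T.subdiagram n then T c.1 c.2 else 0) = j ↔ _
  constructor
  · rintro ⟨h1, h2⟩
    rw [if_pos h1] at h2
    exact ⟨(mem_subdiagram.1 h1).1, h2⟩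
  · rintro ⟨h1, h2⟩
    have h3 : (c.1, c.2) ∈ T.subdiagram n := mem_subdiagram.2 ⟨h1, h2.trans_lt hj⟩
    exact ⟨h3, by rw [if_pos h3, h2]⟩

theorem ssytWeight_last {μ : YoungDiagram} {n : ℕ} (T : BoundedBy (n + 1) μ) :
    ssytWeight T.1 n = μ.card - (T.1.subdiagram n).card := by
  have hsub : (T.1.subdiagram n).cells ⊆ μ.cells := filter_subset _ _
  rw [YoungDiagram.card, YoungDiagram.card, ← card_sdiff_of_subset hsub, ssytWeight]
  refine congrArg card (Finset.ext fun c => ?_)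
  rw [mem_filter, mem_sdiff, subdiagram, mem_filter]
  refine and_congr_right fun hc => ?_
  have := T.2 c hc
  simp only [hc, true_and]
  omega

variable {R : Type*} [CommRing R]

/-- The generating function of tableaux of shape `μ` with entries less than `n`, where `k`
occurrences of the entry `j` contribute the factor `g j k`. -/
noncomputable def genFun (g : ℕ → ℕ → R) (n : ℕ) (μ : YoungDiagram) : R :=
  ∑ T : BoundedBy n μ, ∏ j ∈ range n, g j (ssytWeight T.1 j)

open Classical in
theorem genFun_succ (g : ℕ → ℕ → R) (n : ℕ) (ν : YoungDiagram) {N : ℕ} (hN : ν.card ≤ N) :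
    genFun g (n + 1) ν =
      ∑ μ ∈ cardLE N with IsHorizontalStrip μ ν, g n (ν.card - μ.card) * genFun g n μ := by
  have hmem : ∀ μ, μ ∈ {μ ∈ cardLE N | IsHorizontalStrip μ ν} ↔ IsHorizontalStrip μ ν := fun μ => by
    rw [mem_filter, mem_cardLE, and_iff_right_iff_imp]
    exact fun h => h.card_le.trans hN
  have : Fintype {μ : YoungDiagram // IsHorizontalStrip μ ν} := Fintype.subtype _ hmem
  rw [sum_subtype _ hmem, genFun]
  simp_rw [genFun, mul_sum]
  rw [← Fintype.sum_sigma' (fun (μ : {μ : YoungDiagram // IsHorizontalStrip μ ν})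
    (T : BoundedBy n μ.1) => g n (ν.card - μ.1.card) * ∏ j ∈ range n, g j (ssytWeight T.1 j))]
  refine Fintype.sum_equiv (boundedBySuccEquiv n ν) _ _ fun T => ?_
  rw [prod_range_succ, mul_comm, ssytWeight_last]
  refine congrArg _ (prod_congr rfl fun j hj => ?_)
  exact congrArg (g j) (ssytWeight_restrict T.1 (mem_range.1 hj)).symm

theorem genFun_zero (g : ℕ → ℕ → R) {μ : YoungDiagram} (h : μ ≠ ⊥) : genFun g 0 μ = 0 := by
  refine sum_eq_zero fun T _ => absurd ?_ h
  refine SetLike.ext fun c => ⟨fun hc => ?_, fun hc => absurd hc (notMem_bot c)⟩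
  exact absurd (T.2 c ((mem_cells _).2 hc)) (Nat.not_lt_zero _)

theorem genFun_bot {g : ℕ → ℕ → R} {n : ℕ} (hg : ∀ j < n, g j 0 = 1) : genFun g n ⊥ = 1 := by
  have hT : ∀ T : BoundedBy n ⊥, T = ⟨default, fun c hc => by simp at hc⟩ := fun T =>
    Subtype.ext (SemistandardYoungTableau.ext fun i j => by
      rw [T.1.zeros (notMem_bot _), zeros _ (notMem_bot _)])
  rw [genFun, Fintype.sum_eq_single _ fun T h => absurd (hT T) h]
  refine prod_eq_one fun j hj => ?_
  rw [show ssytWeight _ j = 0 from rfl, hg j (mem_range.1 hj)]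

open Classical in
/-- The Pieri rule for adding one cell. -/
theorem sum_mul_genFun (x : ℕ → R) (n : ℕ) (lam : YoungDiagram) {N : ℕ} (hN : lam.card + 1 ≤ N) :
    (∑ j ∈ range n, x j) * genFun (fun j k => x j ^ k) n lam =
      ∑ ν ∈ cardLE N with ∃ i, AddsCell lam ν i, genFun (fun j k => x j ^ k) n ν := by
  induction n generalizing lam with
  | zero =>
    rw [range_zero, sum_empty, zero_mul]
    refine (sum_eq_zero fun ν hν => genFun_zero _ ?_).symm
    rintro rfl
    obtain ⟨i, hi⟩ := (mem_filter.1 hν).2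
    exact Nat.succ_ne_zero _ hi.card_eq.symm
  | succ n ih =>
    set S := genFun (fun j k => x j ^ k) n with hS
    have hright : ∑ ν ∈ cardLE N with ∃ i, AddsCell lam ν i, genFun (fun j k => x j ^ k) (n + 1) ν =
        ∑ μ ∈ cardLE N, #{ν ∈ cardLE N | (∃ i, AddsCell lam ν i) ∧ IsHorizontalStrip μ ν} *
          (x n ^ (lam.card + 1 - μ.card) * S μ) := by
      rw [sum_filter]
      have : ∀ ν ∈ cardLE N, (if ∃ i, AddsCell lam ν i then
          genFun (fun j k => x j ^ k) (n + 1) ν else 0) =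
          ∑ μ ∈ cardLE N, if (∃ i, AddsCell lam ν i) ∧ IsHorizontalStrip μ ν then
            x n ^ (lam.card + 1 - μ.card) * S μ else 0 := by
        intro ν hν
        split_ifs with h
        · obtain ⟨i, hi⟩ := h
          rw [genFun_succ _ _ _ (mem_cardLE.1 hν), sum_filter, hi.card_eq]
          exact sum_congr rfl fun μ _ => by simp only [show ∃ i, AddsCell lam ν i from ⟨i, hi⟩,
            true_and, hS]
        · simp [h]
      rw [sum_congr rfl this, sum_comm]
      refine sum_congr rfl fun μ _ => ?_
      rw [← sum_filter, sum_const, nsmul_eq_mul]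
    have hleft : (∑ j ∈ range n, x j) * genFun (fun j k => x j ^ k) (n + 1) lam =
        ∑ μ ∈ cardLE N, #{κ ∈ cardLE N | IsHorizontalStrip κ lam ∧ ∃ i, AddsCell κ μ i} *
          (x n ^ (lam.card + 1 - μ.card) * S μ) := by
      rw [genFun_succ _ _ _ (show lam.card ≤ N by omega), mul_sum, sum_filter]
      have : ∀ κ ∈ cardLE N, (if IsHorizontalStrip κ lam then
          (∑ j ∈ range n, x j) * (x n ^ (lam.card - κ.card) * S κ) else 0) =
          ∑ μ ∈ cardLE N, if IsHorizontalStrip κ lam ∧ ∃ i, AddsCell κ μ i then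
            x n ^ (lam.card + 1 - μ.card) * S μ else 0 := by
        intro κ _
        split_ifs with h
        · have := h.card_le
          rw [mul_left_comm, ih κ (by omega), mul_sum, sum_filter]
          refine sum_congr rfl fun μ _ => ?_
          simp only [h, true_and]
          split_ifs with h'
          · obtain ⟨i, hi⟩ := h'
            rw [hi.card_eq, Nat.add_sub_add_right]
          · rfl
        · simp [h]
      rw [sum_congr rfl this, sum_comm]
      refine sum_congr rfl fun μ _ => ?_
      rw [← sum_filter, sum_const, nsmul_eq_mul]
    have hlast : x n * genFun (fun j k => x j ^ k) (n + 1) lam =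
        ∑ μ ∈ cardLE N, ((if IsHorizontalStrip μ lam then 1 else 0 : ℕ) : R) *
          (x n ^ (lam.card + 1 - μ.card) * S μ) := by
      rw [genFun_succ _ _ _ (show lam.card ≤ N by omega), mul_sum, sum_filter]
      refine sum_congr rfl fun μ _ => ?_
      split_ifs with h
      · rw [Nat.succ_sub h.card_le, pow_succ', Nat.cast_one, one_mul, mul_assoc]
      · rw [Nat.cast_zero, zero_mul]
    rw [sum_range_succ, add_mul, hleft, hlast, hright, ← sum_add_distrib]
    refine sum_congr rfl fun μ _ => ?_
    rw [card_filter_addsCell_isHorizontalStrip hN, Nat.cast_add, add_mul]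

open Classical in
theorem sum_pow_eq (x : ℕ → R) (n m : ℕ) {N : ℕ} (hN : m ≤ N) :
    (∑ j ∈ range n, x j) ^ m = ∑ lam ∈ cardLE N with lam.card = m,
      genFun (fun _ k => if k = 1 then (1 : R) else 0) m lam *
        genFun (fun j k => x j ^ k) n lam := by
  induction m with
  | zero =>
    have : {lam ∈ cardLE N | lam.card = 0} = {⊥} := by
      ext lam
      rw [mem_filter, mem_cardLE, mem_singleton]
      refine ⟨fun h => YoungDiagram.ext (card_eq_zero.1 h.2), ?_⟩
      rintro rfl
      exact ⟨Nat.zero_le N, rfl⟩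
    rw [this, sum_singleton, genFun_bot (by simp), genFun_bot (by simp), pow_zero, one_mul]
  | succ m ih =>
    rw [pow_succ, ih (by omega), sum_mul]
    have h1 : ∀ lam ∈ cardLE N, lam.card = m →
        genFun (fun _ k => if k = 1 then (1 : R) else 0) m lam *
          genFun (fun j k => x j ^ k) n lam * ∑ j ∈ range n, x j =
        ∑ ν ∈ cardLE N, if ∃ i, AddsCell lam ν i then
          genFun (fun _ k => if k = 1 then (1 : R) else 0) m lam *
            genFun (fun j k => x j ^ k) n ν else 0 := by
      intro lam _ hlam
      rw [mul_assoc, mul_comm (genFun _ n lam), sum_mul_genFun x n lam (hlam ▸ hN), mul_sum,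
        sum_filter]
    rw [sum_congr rfl fun lam hlam => h1 lam (mem_filter.1 hlam).1 (mem_filter.1 hlam).2,
      sum_comm, sum_filter]
    refine sum_congr rfl fun ν hν => ?_
    split_ifs with hcard
    · rw [genFun_succ _ _ _ (mem_cardLE.1 hν), sum_mul, sum_filter, sum_filter]
      refine sum_congr rfl fun μ _ => ?_
      by_cases h : ∃ i, AddsCell μ ν i
      · obtain ⟨i, hi⟩ := h
        have hc := hi.card_eq
        rw [if_pos (by omega), if_pos ⟨i, hi⟩, if_pos hi.isHorizontalStrip, if_pos (by omega),
          one_mul]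
      · rw [if_neg h, ite_self]
        split_ifs with hs h'
        · exact absurd (hs.exists_addsCell (by omega)) h
        · rw [zero_mul, zero_mul]
        · rfl
    · refine sum_eq_zero fun μ hμ => if_neg ?_
      rintro ⟨i, hi⟩
      exact hcard (by rw [hi.card_eq, (mem_filter.1 hμ).2])

theorem lt_of_ssytWeight_eq_zero {μ : YoungDiagram} {T : SemistandardYoungTableau μ} {n : ℕ}
    (h : ∀ j, n ≤ j → ssytWeight T j = 0) : ∀ c ∈ μ.cells, T c.1 c.2 < n := by
  intro c hc
  by_contra! hn
  have := filter_eq_empty_iff.1 (card_eq_zero.1 (h _ hn)) hc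
  exact this rfl

theorem ssytWeight_eq_zero {μ : YoungDiagram} {n : ℕ} (T : BoundedBy n μ) {j : ℕ} (hj : n ≤ j) :
    ssytWeight T.1 j = 0 :=
  card_eq_zero.2 (filter_eq_empty_iff.2 fun c hc => ((T.2 c hc).trans_le hj).ne)

theorem genFun_eq_tabCard (μ : YoungDiagram) (m : ℕ) :
    genFun (fun _ k => if k = 1 then (1 : R) else 0) m μ = tabCard μ (fun _ : Fin m => 1) := by
  classical
  have h1 : ∀ T : BoundedBy m μ, ∏ j ∈ range m, (if ssytWeight T.1 j = 1 then (1 : R) else 0) =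
      if ∀ j ∈ range m, ssytWeight T.1 j = 1 then 1 else 0 := fun T => prod_boole
  rw [genFun, sum_congr rfl fun T _ => h1 T, sum_boole, tabCard, ← Set.ncard_coe_finset]
  refine congrArg _ (Set.ncard_congr (fun T _ => T.1) ?_ ?_ ?_)
  · intro T hT j
    have hT := (mem_filter.1 (Finset.mem_coe.1 hT)).2
    split_ifs with hj
    · exact hT j (mem_range.2 hj)
    · exact ssytWeight_eq_zero T (not_lt.1 hj)
  · intro T T' _ _ h
    exact Subtype.ext h
  · intro T hT
    refine ⟨⟨T, lt_of_ssytWeight_eq_zero fun j hj => ?_⟩, ?_, rfl⟩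
    · rw [hT j, dif_neg (not_lt.2 hj)]
    · refine Finset.mem_coe.2 (mem_filter.2 ⟨mem_univ _, fun j hj => ?_⟩)
      rw [hT j, dif_pos (mem_range.1 hj)]

end SemistandardYoungTableau

theorem schurPoly_eq_genFun (n : ℕ) (μ : YoungDiagram) :
    schurPoly n μ = SemistandardYoungTableau.genFun
      (fun j k => (if h : j < n then MvPolynomial.X ⟨j, h⟩ else 0 : MvPolynomial (Fin n) ℤ) ^ k)
      n μ := by
  rw [schurPoly, SemistandardYoungTableau.genFun, ← finsum_eq_sum_of_fintype]
  refine (finsum_subtype_eq_finsum_cond fun T : SemistandardYoungTableau μ =>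
    ∀ c ∈ μ.cells, T c.1 c.2 < n).symm.trans ?_
  refine finsum_congr fun T => ?_
  rw [prod_range]
  refine prod_congr rfl fun i _ => ?_
  rw [dif_pos i.2]

open MvPolynomial in
/-- **Schur–Weyl duality on characters.** `(x_1 + ⋯ + x_n)^m = ∑_{λ ⊢ m} f^λ s_λ(x_1,…,x_n)`,
where `f^λ = |Tab(λ, (1,…,1))|` is the number of standard Young tableaux of shape `λ`. -/
theorem schur_weyl_characters (n m : ℕ) (hn : 0 < n) (hm : 0 < m) :
    (∑ i : Fin n, (X i : MvPolynomial (Fin n) ℤ)) ^ m =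
      ∑ᶠ (lam : YoungDiagram) (_ : lam.card = m),
        (tabCard lam (fun _ : Fin m => 1) : MvPolynomial (Fin n) ℤ) * schurPoly n lam := by
  classical
  have hsum : ∑ i : Fin n, (X i : MvPolynomial (Fin n) ℤ) =
      ∑ j ∈ range n, if h : j < n then X ⟨j, h⟩ else 0 := by
    rw [sum_range]
    exact sum_congr rfl fun i _ => by rw [dif_pos i.2]
  rw [hsum, SemistandardYoungTableau.sum_pow_eq _ n m le_rfl]
  have hmem : ∀ lam, lam.card = m ↔ lam ∈ {lam ∈ YoungDiagram.cardLE m | lam.card = m} := by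
    intro lam
    rw [mem_filter, YoungDiagram.mem_cardLE]
    omega
  rw [finsum_congr fun lam => finsum_congr_Prop (propext (hmem lam)) fun _ => rfl,
    finsum_mem_finset_eq_sum]
  refine sum_congr rfl fun lam _ => ?_
  rw [SemistandardYoungTableau.genFun_eq_tabCard, schurPoly_eq_genFun]
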